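/- arXiv:1510.03788 — 3 statements merged into one kernel-verified Lean document; each statement's English description precedes it below -/
import Mathlib

section
/- For every S ∈ S_c(X), one has G(S) ⊆ H(S) ⊆ cl(G(S)), where G(S) = {S ∪ F : F is a nonempty finite subset of X}, H(S) = {T ∈ S_c(X) : S ⊆ T}, and the closure is taken in S_c(X). -/
open Set Topology

/-- The Vietoris topology on the powerset of a topological space, generated by the
standard subbasis.  Restricting it to any family of closed subsets yields the usual
Vietoris hyperspace topology on that family. -/
def vietorisTopology (X : Type*) [TopologicalSpace X] : TopologicalSpace (Set X) :=
  TopologicalSpace.generateFrom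
    {A | (∃ U : Set X, IsOpen U ∧ A = {F : Set X | F ⊆ U}) ∨
         (∃ U : Set X, IsOpen U ∧ A = {F : Set X | (F ∩ U).Nonempty})}

/-- `S` is a nontrivial convergent sequence with limit point `x`:  `S` is countably
infinite, closed, `x` is its unique non-isolated point, and `S \ U` is finite for
every open neighbourhood `U` of `x`. -/
def IsNCS {X : Type*} [TopologicalSpace X] (S : Set X) (x : X) : Prop :=
  S.Infinite ∧ S.Countable ∧ IsClosed S ∧ x ∈ S ∧
    (¬ ∃ U : Set X, IsOpen U ∧ U ∩ S = {x}) ∧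
    (∀ y ∈ S, y ≠ x → ∃ U : Set X, IsOpen U ∧ U ∩ S = {y}) ∧
    (∀ U : Set X, IsOpen U → x ∈ U → (S \ U).Finite)

/-- The hyperspace `S_c(X)` of all nontrivial convergent sequences of `X`. -/
def Sc (X : Type*) [TopologicalSpace X] : Type _ :=
  {S : Set X // ∃ x, IsNCS S x}

/-- `S_c(X)` carries the relative Vietoris topology. -/
instance (X : Type*) [TopologicalSpace X] : TopologicalSpace (Sc X) :=
  TopologicalSpace.induced (fun S => S.1) (vietorisTopology X)

theorem vietoris_aux {X : Type*} [TopologicalSpace X] {T : Set X} {O : Set (Set X)}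
    (hO : IsOpen[vietorisTopology X] O) (hT : T ∈ O) :
    ∃ F : Set X, F.Finite ∧ F ⊆ T ∧ ∀ A : Set X, F ⊆ A → A ⊆ T → A ∈ O := by
  change TopologicalSpace.GenerateOpen _ O at hO
  induction hO with
  | basic s hs =>
    rcases hs with ⟨U, -, rfl⟩ | ⟨U, -, rfl⟩
    · exact ⟨∅, finite_empty, empty_subset _, fun A _ h => h.trans hT⟩
    · obtain ⟨p, hp, hpU⟩ := hT
      exact ⟨{p}, finite_singleton p, singleton_subset_iff.2 hp,
        fun A h _ => ⟨p, h rfl, hpU⟩⟩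
  | univ => exact ⟨∅, finite_empty, empty_subset _, fun _ _ _ => trivial⟩
  | inter s t _ _ ihs iht =>
    obtain ⟨F, hF, hFT, h⟩ := ihs hT.1
    obtain ⟨G, hG, hGT, h'⟩ := iht hT.2
    exact ⟨F ∪ G, hF.union hG, union_subset hFT hGT, fun A hA hAT =>
      ⟨h A (subset_union_left.trans hA) hAT, h' A (subset_union_right.trans hA) hAT⟩⟩
  | sUnion C _ ih =>
    obtain ⟨s, hs, hTs⟩ := hT
    obtain ⟨F, hF, hFT, h⟩ := ih s hs hTs
    exact ⟨F, hF, hFT, fun A hA hAT => ⟨s, hs, h A hA hAT⟩⟩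

theorem iso_aux {X : Type*} {U A B : Set X} {p : X} (h : U ∩ B = {p}) (hAB : A ⊆ B)
    (hp : p ∈ A) : U ∩ A = {p} := by
  apply Subset.antisymm
  · rw [← h]; exact inter_subset_inter_right _ hAB
  · have : p ∈ U ∩ B := by rw [h]; rfl
    exact singleton_subset_iff.2 ⟨this.1, hp⟩

theorem ncs_aux {X : Type*} [TopologicalSpace X] [T1Space X] {S T F : Set X} {x y : X}
    (hS : IsNCS S x) (hT : IsNCS T y) (hST : S ⊆ T) (hF : F.Finite) (hFT : F ⊆ T) :
    IsNCS (S ∪ F) x := by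
  obtain ⟨hi, hc, hcl, hx, hn, -, -⟩ := hS
  obtain ⟨-, -, -, -, -, hiso, hfin⟩ := hT
  have hxy : x = y := by
    by_contra hne
    obtain ⟨U, hU, h⟩ := hiso x (hST hx) hne
    exact hn ⟨U, hU, iso_aux h hST hx⟩
  subst hxy
  have hsub : S ∪ F ⊆ T := union_subset hST hFT
  refine ⟨hi.mono subset_union_left, hc.union hF.countable, hcl.union hF.isClosed,
    Or.inl hx, ?_, ?_, ?_⟩
  · rintro ⟨U, hU, h⟩
    exact hn ⟨U, hU, iso_aux h subset_union_left hx⟩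
  · intro z hz hne
    obtain ⟨U, hU, h⟩ := hiso z (hsub hz) hne
    exact ⟨U, hU, iso_aux h hsub hz⟩
  · intro U hU hxU
    exact (hfin U hU hxU).subset (sdiff_subset_sdiff_left hsub)

/-- For every `S ∈ S_c(X)` one has `G(S) ⊆ H(S) ⊆ cl(G(S))`, where
`G(S) = {S ∪ F : F a nonempty finite subset of X}` and `H(S) = {T ∈ S_c(X) : S ⊆ T}`,
the closure being taken in `S_c(X)`. -/
theorem stmt_6 {X : Type*} [TopologicalSpace X] [T1Space X] [Infinite X]
    [FrechetUrysohnSpace X] (hnd : ¬ DiscreteTopology X) (S : Sc X) :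
    {T : Sc X | ∃ F : Set X, F.Finite ∧ F.Nonempty ∧ T.1 = S.1 ∪ F} ⊆
      {T : Sc X | S.1 ⊆ T.1} ∧
    {T : Sc X | S.1 ⊆ T.1} ⊆
      closure {T : Sc X | ∃ F : Set X, F.Finite ∧ F.Nonempty ∧ T.1 = S.1 ∪ F} := by
  refine ⟨?_, ?_⟩
  · rintro T ⟨F, -, -, h⟩
    change S.1 ⊆ T.1
    rw [h]; exact subset_union_left
  · intro T hST
    change S.1 ⊆ T.1 at hST
    rw [mem_closure_iff]
    intro O hO hTO
    obtain ⟨O', hO', rfl⟩ := (@isOpen_induced_iff _ _ (vietorisTopology X) _ _).1 hO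
    obtain ⟨F, hF, hFT, hA⟩ := vietoris_aux (T := T.1) hO' hTO
    obtain ⟨x, hx⟩ := S.2
    obtain ⟨y, hy⟩ := T.2
    have key := ncs_aux hx hy hST (F := insert x F) (hF.insert x)
      (insert_subset (hST hx.2.2.2.1) hFT)
    refine ⟨⟨S.1 ∪ insert x F, x, key⟩, ?_, insert x F, hF.insert x, insert_nonempty _ _, rfl⟩
    exact hA _ ((subset_insert _ _).trans subset_union_right)
      (union_subset hST (insert_subset (hST hx.2.2.2.1) hFT))
end

section
/- If X is locally connected, then the hyperspace S_c(X) of nontrivial convergent sequences of X is locally connected. -/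
open Set Topology

theorem IsNCS.insert' {X : Type*} [TopologicalSpace X] [T1Space X] {S : Set X} {x : X}
    (h : IsNCS S x) (a : X) : IsNCS (insert a S) x := by
  by_cases ha : a ∈ S
  · rwa [Set.insert_eq_of_mem ha]
  obtain ⟨h1, h2, h3, h4, h5, h6, h7⟩ := h
  refine ⟨h1.mono (subset_insert _ _), h2.insert a, ?_, Or.inr h4, ?_, ?_, ?_⟩
  · rw [Set.insert_eq]; exact isClosed_singleton.union h3
  · rintro ⟨U, hU, he⟩
    refine h5 ⟨U, hU, ?_⟩
    apply Set.Subset.antisymm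
    · rw [← he]; exact inter_subset_inter_right _ (subset_insert _ _)
    · rintro y rfl
      have : y ∈ U ∩ insert a S := by rw [he]; rfl
      exact ⟨this.1, h4⟩
  · intro y hy hyx
    rcases hy with rfl | hy
    · refine ⟨Sᶜ, h3.isOpen_compl, ?_⟩
      ext z; simp only [mem_inter_iff, mem_compl_iff, mem_insert_iff, mem_singleton_iff]
      constructor
      · tauto
      · rintro rfl; tauto
    · obtain ⟨U, hU, he⟩ := h6 y hy hyx
      refine ⟨U \ {a}, hU.sdiff isClosed_singleton, ?_⟩
      ext z
      have hz := Set.ext_iff.1 he z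
      simp only [mem_inter_iff, mem_sdiff, mem_insert_iff, mem_singleton_iff] at hz ⊢
      constructor
      · tauto
      · rintro rfl
        have : z ≠ a := by rintro rfl; exact ha hy
        tauto
  · intro U hU hx
    refine ((h7 U hU hx).insert a).subset ?_
    rintro z ⟨rfl | hz, hzU⟩
    · exact Or.inl rfl
    · exact Or.inr ⟨hz, hzU⟩

theorem IsNCS.diff1 {X : Type*} [TopologicalSpace X] [T1Space X] {S : Set X} {x : X}
    (h : IsNCS S x) {a : X} (hax : a ≠ x) : IsNCS (S \ {a}) x := by
  by_cases ha : a ∈ S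
  swap
  · rwa [Set.sdiff_singleton_eq_self ha]
  obtain ⟨h1, h2, h3, h4, h5, h6, h7⟩ := h
  refine ⟨h1.sdiff (finite_singleton a), h2.mono sdiff_subset, ?_, ⟨h4, fun h => hax h.symm⟩, ?_, ?_, ?_⟩
  · obtain ⟨U, hU, he⟩ := h6 a ha hax
    have : S \ {a} = S ∩ Uᶜ := by
      ext z
      have hz := Set.ext_iff.1 he z
      simp only [mem_inter_iff, mem_sdiff, mem_compl_iff, mem_singleton_iff] at hz ⊢
      tauto
    rw [this]; exact h3.inter hU.isClosed_compl
  · rintro ⟨U, hU, he⟩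
    refine h5 ⟨U \ {a}, hU.sdiff isClosed_singleton, ?_⟩
    rw [← he]; ext z; simp only [mem_inter_iff, mem_sdiff]; tauto
  · intro y hy hyx
    obtain ⟨U, hU, he⟩ := h6 y hy.1 hyx
    refine ⟨U, hU, ?_⟩
    ext z
    have hz := Set.ext_iff.1 he z
    simp only [mem_inter_iff, mem_sdiff, mem_singleton_iff] at hz ⊢
    constructor
    · tauto
    · rintro rfl; exact ⟨(hz.2 rfl).1, hy⟩
  · intro U hU hx
    exact (h7 U hU hx).subset (sdiff_subset_sdiff_left sdiff_subset)

theorem IsNCS.union_fin {X : Type*} [TopologicalSpace X] [T1Space X] {S : Set X} {x : X}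
    (h : IsNCS S x) {F : Set X} (hF : F.Finite) : IsNCS (S ∪ F) x := by
  induction F, hF using Set.Finite.induction_on with
  | empty => simpa using h
  | insert _ _ ih => rw [union_insert]; exact ih.insert' _

theorem IsNCS.diff_fin {X : Type*} [TopologicalSpace X] [T1Space X] {S : Set X} {x : X}
    (h : IsNCS S x) {F : Set X} (hF : F.Finite) (hx : x ∉ F) : IsNCS (S \ F) x := by
  induction F, hF using Set.Finite.induction_on with
  | empty => simpa using h
  | @insert a s _ _ ih =>
    have : S \ insert a s = (S \ s) \ {a} := by ext; simp; tauto
    rw [this]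
    simp only [mem_insert_iff, not_or] at hx
    exact (ih hx.2).diff1 (fun h => hx.1 h.symm)

theorem vietoris_basic {X : Type*} [TopologicalSpace X] {A : Set (Set X)}
    (hA : @IsOpen _ (vietorisTopology X) A) : ∀ S ∈ A, ∃ (O : Set X) (G : Set (Set X)),
      IsOpen O ∧ G.Finite ∧ (∀ g ∈ G, IsOpen g) ∧ S ⊆ O ∧ (∀ g ∈ G, (S ∩ g).Nonempty) ∧
      ∀ T : Set X, T ⊆ O → (∀ g ∈ G, (T ∩ g).Nonempty) → T ∈ A := by
  change TopologicalSpace.GenerateOpen _ A at hA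
  induction hA with
  | basic A h =>
    rcases h with ⟨U, hU, rfl⟩ | ⟨U, hU, rfl⟩
    · intro S hS
      exact ⟨U, ∅, hU, finite_empty, by simp, hS, by simp, fun T hT _ => hT⟩
    · intro S hS
      exact ⟨univ, {U}, isOpen_univ, finite_singleton _, by simpa using hU, subset_univ _,
        by simpa using hS, fun T _ hT => hT U rfl⟩
  | univ => 
    intro S hS
    exact ⟨univ, ∅, isOpen_univ, finite_empty, by simp, subset_univ _, by simp, fun T _ _ => trivial⟩
  | inter A B _ _ ihA ihB =>
    intro S hS
    obtain ⟨O, G, a1, a2, a3, a4, a5, a6⟩ := ihA S hS.1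
    obtain ⟨O', G', b1, b2, b3, b4, b5, b6⟩ := ihB S hS.2
    refine ⟨O ∩ O', G ∪ G', a1.inter b1, a2.union b2, ?_, subset_inter a4 b4, ?_, ?_⟩
    · rintro g (h | h); exacts [a3 g h, b3 g h]
    · rintro g (h | h); exacts [a5 g h, b5 g h]
    · intro T hT hT'
      exact ⟨a6 T (hT.trans inter_subset_left) fun g hg => hT' g (Or.inl hg),
        b6 T (hT.trans inter_subset_right) fun g hg => hT' g (Or.inr hg)⟩
  | sUnion 𝒜 _ ih =>
    rintro S ⟨A, hA, hS⟩
    obtain ⟨O, G, a1, a2, a3, a4, a5, a6⟩ := ih A hA S hS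
    exact ⟨O, G, a1, a2, a3, a4, a5, fun T h h' => ⟨A, hA, a6 T h h'⟩⟩

theorem Sc_basic {X : Type*} [TopologicalSpace X] {A : Set (Sc X)}
    (hA : IsOpen A) (S : Sc X) (hS : S ∈ A) : ∃ (O : Set X) (G : Set (Set X)),
      IsOpen O ∧ G.Finite ∧ (∀ g ∈ G, IsOpen g) ∧ S.1 ⊆ O ∧ (∀ g ∈ G, (S.1 ∩ g).Nonempty) ∧
      ∀ T : Sc X, T.1 ⊆ O → (∀ g ∈ G, (T.1 ∩ g).Nonempty) → T ∈ A := by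
  letI := vietorisTopology X
  obtain ⟨B, hB, rfl⟩ := isOpen_induced_iff.1 hA
  obtain ⟨O, G, a1, a2, a3, a4, a5, a6⟩ := vietoris_basic hB S.1 hS
  exact ⟨O, G, a1, a2, a3, a4, a5, fun T h h' => a6 T.1 h h'⟩

def scW {X : Type*} [TopologicalSpace X] (U : Set (Set X)) : Set (Sc X) :=
  {S | S.1 ⊆ ⋃₀ U ∧ ∀ u ∈ U, (S.1 ∩ u).Nonempty}

theorem isOpen_Sc_sub {X : Type*} [TopologicalSpace X] {U : Set X} (hU : IsOpen U) :
    IsOpen {S : Sc X | S.1 ⊆ U} :=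
  letI := vietorisTopology X; isOpen_induced_iff.2 ⟨{F | F ⊆ U}, TopologicalSpace.isOpen_generateFrom_of_mem
    (Or.inl ⟨U, hU, rfl⟩), rfl⟩

theorem isOpen_Sc_hit {X : Type*} [TopologicalSpace X] {U : Set X} (hU : IsOpen U) :
    IsOpen {S : Sc X | (S.1 ∩ U).Nonempty} :=
  letI := vietorisTopology X; isOpen_induced_iff.2 ⟨{F | (F ∩ U).Nonempty}, TopologicalSpace.isOpen_generateFrom_of_mem
    (Or.inr ⟨U, hU, rfl⟩), rfl⟩

theorem isOpen_scW {X : Type*} [TopologicalSpace X] {U : Set (Set X)} (hf : U.Finite)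
    (hU : ∀ u ∈ U, IsOpen u) : IsOpen (scW U) := by
  have : scW U = {S : Sc X | S.1 ⊆ ⋃₀ U} ∩ ⋂ u ∈ U, {S : Sc X | (S.1 ∩ u).Nonempty} := by
    ext S; simp [scW]
  rw [this]
  exact (isOpen_Sc_sub (isOpen_sUnion hU)).inter
    (hf.isOpen_biInter fun u hu => isOpen_Sc_hit (hU u hu))

def scIns {X : Type*} [TopologicalSpace X] [T1Space X] (S : Sc X) (a : X) : Sc X :=
  ⟨insert a S.1, S.2.imp fun _ h => h.insert' a⟩

theorem continuous_scIns {X : Type*} [TopologicalSpace X] [T1Space X] (S : Sc X) :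
    Continuous (scIns S) := by
  letI := vietorisTopology X
  refine continuous_induced_rng.2 (continuous_generateFrom_iff.2 ?_)
  rintro A (⟨U, hU, rfl⟩ | ⟨U, hU, rfl⟩)
  · by_cases h : S.1 ⊆ U
    · convert hU using 1
      ext a; simp [scIns, insert_subset_iff, h]
    · convert isOpen_empty using 1
      ext a; simp [scIns, insert_subset_iff, h]
  · by_cases h : (S.1 ∩ U).Nonempty
    · convert isOpen_univ using 1
      ext a; simp only [mem_preimage, Function.comp, scIns, mem_setOf_eq, mem_univ, iff_true]
      exact h.mono (inter_subset_inter_left _ (subset_insert _ _))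
    · convert hU using 1
      ext a; simp only [mem_preimage, Function.comp, scIns, mem_setOf_eq]
      constructor
      · rintro ⟨z, rfl | hz, hzU⟩
        · exact hzU
        · exact (h ⟨z, hz, hzU⟩).elim
      · intro ha; exact ⟨a, Or.inl rfl, ha⟩

/-- Joined by a preconnected subset. -/
def PJ {Y : Type*} [TopologicalSpace Y] (W : Set Y) (a b : Y) : Prop :=
  ∃ t ⊆ W, a ∈ t ∧ b ∈ t ∧ IsPreconnected t

theorem PJ.trans' {Y : Type*} [TopologicalSpace Y] {W : Set Y} {a b c : Y}
    (h : PJ W a b) (h' : PJ W b c) : PJ W a c := by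
  obtain ⟨t, h1, h2, h3, h4⟩ := h
  obtain ⟨s, g1, g2, g3, g4⟩ := h'
  exact ⟨t ∪ s, union_subset h1 g1, Or.inl h2, Or.inr g3, h4.union b h3 g2 g4⟩

theorem PJ.symm' {Y : Type*} [TopologicalSpace Y] {W : Set Y} {a b : Y}
    (h : PJ W a b) : PJ W b a := by
  obtain ⟨t, h1, h2, h3, h4⟩ := h
  exact ⟨t, h1, h3, h2, h4⟩

theorem PJ.ofclosure {Y : Type*} [TopologicalSpace Y] {W : Set Y} {a b : Y}
    (hb : b ∈ W) (ha : a ∈ W)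
    (h : ∀ N, IsOpen N → b ∈ N → ∃ c ∈ N, PJ W a c) : PJ W a b := by
  have hs := connectedComponentIn_subset W a
  have key : b ∈ closure (connectedComponentIn W a) := by
    rw [mem_closure_iff]
    intro N hN hbN
    obtain ⟨c, hc, t, h1, h2, h3, h4⟩ := h N hN hbN
    exact ⟨c, hc, h4.subset_connectedComponentIn h2 h1 h3⟩
  refine ⟨insert b (connectedComponentIn W a), insert_subset hb hs,
    Or.inr (mem_connectedComponentIn ha), Or.inl rfl, ?_⟩
  exact isPreconnected_connectedComponentIn.subset_closure (subset_insert _ _)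
    (insert_subset key subset_closure)

theorem PJ_ins {X : Type*} [TopologicalSpace X] [T1Space X] {U : Set (Set X)}
    (hU : ∀ u ∈ U, IsPreconnected u) {S : Sc X} (hS : S ∈ scW U) {a : X} (ha : a ∈ ⋃₀ U) :
    PJ (scW U) S (scIns S a) := by
  obtain ⟨u, hu, hau⟩ := ha
  obtain ⟨s, hs, hsu⟩ := hS.2 u hu
  refine ⟨scIns S '' u, ?_, ⟨s, hsu, Subtype.ext (insert_eq_of_mem hs)⟩, ⟨a, hau, rfl⟩,
    (hU u hu).image _ (continuous_scIns S).continuousOn⟩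
  rintro _ ⟨b, hb, rfl⟩
  exact ⟨insert_subset ⟨u, hu, hb⟩ hS.1, fun v hv => (hS.2 v hv).mono
    (inter_subset_inter_left _ (subset_insert _ _))⟩

theorem PJ_fin {X : Type*} [TopologicalSpace X] [T1Space X] {U : Set (Set X)}
    (hU : ∀ u ∈ U, IsPreconnected u) {S : Sc X} (hS : S ∈ scW U) {F : Set X} (hF : F.Finite) :
    F ⊆ ⋃₀ U → ∀ T : Sc X, T.1 = S.1 ∪ F → PJ (scW U) S T := by
  induction F, hF using Set.Finite.induction_on with
  | empty =>
    intro _ T hT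
    have : T = S := Subtype.ext (by simpa using hT)
    subst this
    exact ⟨{T}, by simpa using hS, rfl, rfl, isPreconnected_singleton⟩
  | @insert a s _ hs ih =>
    intro hsub T hT
    rw [insert_subset_iff] at hsub
    let R : Sc X := ⟨S.1 ∪ s, S.2.imp fun _ h => h.union_fin hs⟩
    have h1 : PJ (scW U) S R := ih hsub.2 R rfl
    have hR : R ∈ scW U := by obtain ⟨t, h1, h2, h3, h4⟩ := h1; exact h1 h3
    have : T = scIns R a := Subtype.ext (by rw [hT, union_insert]; rfl)
    rw [this]
    exact h1.trans' (PJ_ins hU hR hsub.1)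

theorem scW_preconnected {X : Type*} [TopologicalSpace X] [T1Space X] {U : Set (Set X)}
    (hf : U.Finite) (hUo : ∀ u ∈ U, IsOpen u)
    (hU : ∀ u ∈ U, IsPreconnected u) : IsPreconnected (scW U) := by
  apply isPreconnected_of_forall_pair
  intro S hS T hT
  change PJ (scW U) S T
  obtain ⟨z, hz⟩ := T.2
  have hzT : z ∈ T.1 := hz.2.2.2.1
  have hzU := hT.1 hzT
  have h1 := PJ_ins hU hS hzU
  refine h1.trans' (PJ.symm' ?_)
  have hR : scIns S z ∈ scW U := by obtain ⟨t, h1, h2, h3, h4⟩ := h1; exact h1 h3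
  refine PJ.ofclosure hR hT ?_
  intro N hN hRN
  obtain ⟨O, G, a1, a2, a3, a4, a5, a6⟩ := Sc_basic hN _ hRN
  have hall : ∀ g : ↥(G ∪ U), ((scIns S z).1 ∩ g.1).Nonempty := by
    rintro ⟨g, hg | hg⟩
    · exact a5 g hg
    · exact hR.2 g hg
  choose f hf1 using hall
  haveI : Finite ↥(G ∪ U) := (a2.union hf).to_subtype
  have hFf : (range f).Finite := finite_range f
  have hFsub : range f ⊆ (scIns S z).1 := by rintro _ ⟨g, rfl⟩; exact (hf1 g).1
  have hzO : z ∈ O := a4 (Or.inl rfl)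
  have hDf : (T.1 \ O).Finite := hz.2.2.2.2.2.2 O a1 hzO
  let Q : Sc X := ⟨(T.1 \ (T.1 \ O)) ∪ range f,
    z, (hz.diff_fin hDf (fun h => h.2 hzO)).union_fin hFf⟩
  have hQW : Q ∈ scW U := by
    refine ⟨union_subset (sdiff_subset.trans hT.1) (hFsub.trans hR.1), fun u hu => ?_⟩
    exact ⟨f ⟨u, Or.inr hu⟩, Or.inr ⟨_, rfl⟩, (hf1 ⟨u, Or.inr hu⟩).2⟩
  refine ⟨Q, a6 Q (union_subset ?_ (hFsub.trans a4)) fun g hg => ?_, ?_⟩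
  · intro y hy; by_contra h; exact hy.2 ⟨hy.1, h⟩
  · exact ⟨f ⟨g, Or.inl hg⟩, Or.inr ⟨_, rfl⟩, (hf1 ⟨g, Or.inl hg⟩).2⟩
  · let P : Sc X := ⟨T.1 ∪ range f, z, hz.union_fin hFf⟩
    have h2 : PJ (scW U) T P := PJ_fin hU hT hFf (hFsub.trans hR.1) P rfl
    refine h2.trans' (PJ.symm' ?_)
    refine PJ_fin hU hQW hDf (sdiff_subset.trans hT.1) P ?_
    ext y; simp only [P, Q, mem_union, mem_sdiff]; tauto

/-- If `X` is locally connected, then `S_c(X)` is locally connected. -/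
theorem stmt_9 {X : Type*} [TopologicalSpace X] [T1Space X] [Infinite X]
    [FrechetUrysohnSpace X] (hnd : ¬ DiscreteTopology X)
    (hX : LocallyConnectedSpace X) : LocallyConnectedSpace (Sc X) := by
  rw [locallyConnectedSpace_iff_subsets_isOpen_isConnected]
  intro S N hN
  obtain ⟨A, hAN, hA, hSA⟩ := mem_nhds_iff.1 hN
  obtain ⟨O, G, a1, a2, a3, a4, a5, a6⟩ := Sc_basic hA S hSA
  obtain ⟨x, hx⟩ := S.2
  have hV : ∀ s : S.1, ∃ V : Set X, V ⊆ O ∧ (∀ g ∈ G, s.1 ∈ g → V ⊆ g) ∧ IsOpen V ∧ s.1 ∈ V ∧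
      IsConnected V := by
    intro s
    have hfin : {g ∈ G | s.1 ∈ g}.Finite := a2.subset (sep_subset _ _)
    have hn : O ∩ ⋂ g ∈ {g ∈ G | s.1 ∈ g}, g ∈ 𝓝 s.1 := by
      apply IsOpen.mem_nhds
      · exact a1.inter (hfin.isOpen_biInter fun g hg => a3 g hg.1)
      · exact ⟨a4 s.2, by simp⟩
    obtain ⟨V, v1, v2, v3, v4⟩ := locallyConnectedSpace_iff_subsets_isOpen_isConnected.1 hX s.1 _ hn
    refine ⟨V, v1.trans inter_subset_left, fun g hg hs => ?_, v2, v3, v4⟩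
    exact (v1.trans inter_subset_right).trans (biInter_subset_of_mem ⟨hg, hs⟩)
  choose V v1 v2 v3 v4 v5 using hV
  have hxS : x ∈ S.1 := hx.2.2.2.1
  have hgs : ∀ g : G, ∃ s : S.1, s.1 ∈ g.1 := fun g => by
    obtain ⟨s, hs, hg⟩ := a5 g.1 g.2
    exact ⟨⟨s, hs⟩, hg⟩
  choose p hp using hgs
  haveI : Finite G := a2.to_subtype
  let I : Set S.1 := insert ⟨x, hxS⟩ (Subtype.val ⁻¹' (S.1 \ V ⟨x, hxS⟩)) ∪ range p
  have hI : I.Finite := by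
    refine (Finite.insert _ ?_).union (finite_range p)
    exact (hx.2.2.2.2.2.2 _ (v3 ⟨x, hxS⟩) (v4 ⟨x, hxS⟩)).preimage Subtype.val_injective.injOn
  have hUo : ∀ u ∈ V '' I, IsOpen u := by rintro _ ⟨s, _, rfl⟩; exact v3 s
  refine ⟨scW (V '' I), ?_, isOpen_scW (hI.image V) hUo, ?_, ?_, ?_⟩
  · intro T hT
    refine hAN (a6 T ?_ ?_)
    · refine hT.1.trans (sUnion_subset ?_)
      rintro _ ⟨s, _, rfl⟩; exact v1 s
    · intro g hg
      refine (hT.2 (V (p ⟨g, hg⟩)) ⟨_, Or.inr ⟨_, rfl⟩, rfl⟩).mono ?_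
      exact inter_subset_inter_right _ (v2 _ g hg (hp ⟨g, hg⟩))
  rotate_left
  · refine ⟨S, ?_⟩
    refine ⟨?_, ?_⟩
    · intro y hy
      by_cases h : y ∈ V ⟨x, hxS⟩
      · exact ⟨_, ⟨_, Or.inl (Or.inl rfl), rfl⟩, h⟩
      · exact ⟨V ⟨y, hy⟩, ⟨_, Or.inl (Or.inr ⟨hy, h⟩), rfl⟩, v4 ⟨y, hy⟩⟩
    · rintro _ ⟨s, _, rfl⟩; exact ⟨s.1, s.2, v4 s⟩
  · exact scW_preconnected (hI.image V) hUo (by rintro _ ⟨s, _, rfl⟩; exact (v5 s).isPreconnected)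
  · refine ⟨?_, ?_⟩
    · intro y hy
      by_cases h : y ∈ V ⟨x, hxS⟩
      · exact ⟨_, ⟨_, Or.inl (Or.inl rfl), rfl⟩, h⟩
      · exact ⟨V ⟨y, hy⟩, ⟨_, Or.inl (Or.inr ⟨hy, h⟩), rfl⟩, v4 ⟨y, hy⟩⟩
    · rintro _ ⟨s, _, rfl⟩; exact ⟨s.1, s.2, v4 s⟩
end

section
/- Let X be a Hausdorff space and let K(X) denote the hyperspace of nonempty compact subsets of X with the Vietoris topology. If A is a compact connected subset of K(X) and S ∈ A, then every connected component of the union ⋃A (taken in X) intersects S. -/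
open Set Topology

/-- The hyperspace `K(X)` of nonempty compact subsets of `X`. -/
def KCpt (X : Type*) [TopologicalSpace X] : Type _ :=
  {K : Set X // IsCompact K ∧ K.Nonempty}

/-- `K(X)` carries the Vietoris topology. -/
instance (X : Type*) [TopologicalSpace X] : TopologicalSpace (KCpt X) :=
  TopologicalSpace.induced (fun K => K.1) (vietorisTopology X)

theorem KCpt.isOpen_sub {X : Type*} [TopologicalSpace X] {U : Set X} (hU : IsOpen U) :
    IsOpen {K : KCpt X | K.1 ⊆ U} :=
  ⟨{F | F ⊆ U}, TopologicalSpace.isOpen_generateFrom_of_mem (Or.inl ⟨U, hU, rfl⟩), rfl⟩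

theorem KCpt.isOpen_meet {X : Type*} [TopologicalSpace X] {U : Set X} (hU : IsOpen U) :
    IsOpen {K : KCpt X | (K.1 ∩ U).Nonempty} :=
  ⟨{F | (F ∩ U).Nonempty},
    TopologicalSpace.isOpen_generateFrom_of_mem (Or.inr ⟨U, hU, rfl⟩), rfl⟩

theorem KCpt.isCompact_union {X : Type*} [TopologicalSpace X]
    (A : Set (KCpt X)) (hA : IsCompact A) : IsCompact (⋃ K ∈ A, K.1) := by
  refine isCompact_of_finite_subcover fun {ι} U hU hcov => ?_
  have key : ∃ t : Finset ι, ∀ K ∈ A, K.1 ⊆ ⋃ i ∈ t, U i := by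
    refine hA.induction_on (p := fun B => ∃ t : Finset ι, ∀ K ∈ B, K.1 ⊆ ⋃ i ∈ t, U i)
      ⟨∅, by simp⟩ ?_ ?_ ?_
    · rintro s t hst ⟨u, hu⟩
      exact ⟨u, fun K hK => hu K (hst hK)⟩
    · classical
      rintro s t ⟨u, hu⟩ ⟨v, hv⟩
      refine ⟨u ∪ v, fun K hK => ?_⟩
      rcases hK with hK | hK
      · exact (hu K hK).trans (biUnion_subset_biUnion_left (fun i hi => Finset.mem_union_left _ hi))
      · exact (hv K hK).trans (biUnion_subset_biUnion_left (fun i hi => Finset.mem_union_right _ hi))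
    · intro K hK
      obtain ⟨t, ht⟩ := K.2.1.elim_finite_subcover U hU
        ((subset_biUnion_of_mem (u := fun K : KCpt X => K.1) hK).trans hcov)
      exact ⟨_, mem_nhdsWithin_of_mem_nhds
        ((KCpt.isOpen_sub (isOpen_biUnion fun i _ => hU i)).mem_nhds ht), t, fun L hL => hL⟩
  obtain ⟨t, ht⟩ := key
  exact ⟨t, iUnion₂_subset ht⟩

/-- If `X` is Hausdorff, `A` is a compact connected subset of `K(X)` and `S ∈ A`,
then every connected component of `⋃A` intersects `S`. -/
theorem stmt_12 {X : Type*} [TopologicalSpace X] [T2Space X]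
    (A : Set (KCpt X)) (hAcpt : IsCompact A) (hAconn : IsConnected A)
    (S : KCpt X) (hS : S ∈ A) (x : X) (hx : x ∈ ⋃ K ∈ A, K.1) :
    (connectedComponentIn (⋃ K ∈ A, K.1) x ∩ S.1).Nonempty := by
  by_contra hne
  rw [not_nonempty_iff_eq_empty] at hne
  have hYc := KCpt.isCompact_union A hAcpt
  have hSY : S.1 ⊆ ⋃ K ∈ A, K.1 := subset_biUnion_of_mem (u := fun K : KCpt X => K.1) hS
  have hKY : ∀ K ∈ A, K.1 ⊆ ⋃ K ∈ A, K.1 := fun K hK =>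
    subset_biUnion_of_mem (u := fun K : KCpt X => K.1) hK
  obtain ⟨K₀, hK₀, hxK₀⟩ := mem_iUnion₂.1 hx
  rw [connectedComponentIn_eq_image hx] at hne
  generalize (⋃ K ∈ A, K.1) = Y at *
  have : CompactSpace Y := isCompact_iff_compactSpace.1 hYc
  have hS' : IsCompact (Subtype.val ⁻¹' S.1 : Set Y) :=
    (S.2.1.isClosed.preimage continuous_subtype_val).isCompact
  have hemp : (Subtype.val ⁻¹' S.1 : Set Y) ∩
      ⋂ s : { s : Set Y // IsClopen s ∧ (⟨x, hx⟩ : Y) ∈ s }, s.1 = ∅ := by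
    rw [← connectedComponent_eq_iInter_isClopen, eq_empty_iff_forall_notMem]
    rintro y ⟨hyS, hyC⟩
    exact (eq_empty_iff_forall_notMem.1 hne) y.1 ⟨⟨y, hyC, rfl⟩, hyS⟩
  have : Nonempty { s : Set Y // IsClopen s ∧ (⟨x, hx⟩ : Y) ∈ s } :=
    ⟨⟨univ, isClopen_univ, mem_univ _⟩⟩
  obtain ⟨⟨Z, hZ, hxZ⟩, hZS⟩ := hS'.elim_directed_family_closed
    (fun s : { s : Set Y // IsClopen s ∧ (⟨x, hx⟩ : Y) ∈ s } => s.1)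
    (fun s => s.2.1.isClosed) hemp
    (fun s t => ⟨⟨s.1 ∩ t.1, s.2.1.inter t.2.1, s.2.2, t.2.2⟩,
      inter_subset_left, inter_subset_right⟩)
  obtain ⟨U, hU, hUZ⟩ := isOpen_induced_iff.1 hZ.isOpen
  obtain ⟨V, hV, hVZ⟩ := isOpen_induced_iff.1 hZ.compl.isOpen
  have hUm : ∀ y : Y, y.1 ∈ U ↔ y ∈ Z := fun y => by rw [← hUZ]; rfl
  have hVm : ∀ y : Y, y.1 ∈ V ↔ y ∉ Z := fun y => by rw [← mem_compl_iff, ← hVZ]; rfl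
  obtain ⟨K, hK, ⟨y, hyK, hyU⟩, hKV⟩ := hAconn.isPreconnected _ _
    (KCpt.isOpen_meet hU) (KCpt.isOpen_sub hV)
    (fun K hK => by
      by_cases h : (K.1 ∩ U).Nonempty
      · exact Or.inl h
      · refine Or.inr fun y hy => ?_
        exact (hVm ⟨y, hKY K hK hy⟩).2 fun hz => h ⟨y, hy, (hUm ⟨y, hKY K hK hy⟩).2 hz⟩)
    ⟨K₀, hK₀, x, hxK₀, (hUm ⟨x, hx⟩).2 hxZ⟩
    ⟨S, hS, fun y hy => (hVm ⟨y, hSY hy⟩).2 fun hz =>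
      (eq_empty_iff_forall_notMem.1 hZS) ⟨y, hSY hy⟩ ⟨hy, hz⟩⟩
  exact (hVm ⟨y, hKY K hK hyK⟩).1 (hKV hyK) ((hUm ⟨y, hKY K hK hyK⟩).1 hyU)
end
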